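/- An FSA S = (X, T, X_0, δ, Σ, ℓ) with faulty event set T_f is not T_f-predictable if and only if in the concurrent composition CC_A(S^n; S^n) there is a reachable state (x_1, x̄_1) such that (x_1, t_f, x_2) ∈ δ for some t_f ∈ T_f and x_2 ∈ X, and in S^n there is a state x_3 equal to x̄_1 or reachable from x̄_1 that belongs to a transition cycle of S^n. -/

import Mathlib

namespace DES

/-- Run of a labelled transition system along a finite word of events. -/
inductive RunRel {S : Type*} {E : Type*} (δ : S → E → S → Prop) : S → List E → S → Prop
  | nil (x : S) : RunRel δ x [] x
  | cons {x y z : S} {e : E} {w : List E} :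
      δ x e y → RunRel δ y w z → RunRel δ x (e :: w) z

/-- A labelling function (with `none` playing the role of the empty label ε)
extended to words by concatenation (ε's disappear). -/
def obsW {T : Type*} {Λ : Type*} (ℓ : T → Option Λ) (w : List T) : List Λ :=
  w.filterMap ℓ

/-- A finite-state automaton (FSA) `S = (X, T, X₀, δ, Σ, ℓ)`:
states `X`, events `T`, initial states `init`, transition relation `trans`,
labels `Λ`, labelling function `lbl` (with `none` = ε, i.e. unobservable). -/
structure FSA (X : Type*) (T : Type*) (Λ : Type*) where
  init : Set X
  trans : Set (X × T × X)
  lbl : T → Option Λ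

namespace FSA

variable {X : Type*} {T : Type*} {Λ : Type*}

def step (A : FSA X T Λ) (x : X) (t : T) (y : X) : Prop := (x, t, y) ∈ A.trans

/-- extension of the transition relation to words. -/
def Run (A : FSA X T Λ) : X → List T → X → Prop := RunRel A.step

/-- `L(S)`: finite event sequences generated from initial states. -/
def Lang (A : FSA X T Λ) : Set (List T) := {w | ∃ x0 ∈ A.init, ∃ x, A.Run x0 w x}

def InfRun (A : FSA X T Λ) (x : ℕ → X) (s : ℕ → T) : Prop :=
  x 0 ∈ A.init ∧ ∀ n, A.step (x n) (s n) (x (n + 1))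

/-- `L^ω(S)`: infinite event sequences generated from initial states. -/
def LangW (A : FSA X T Λ) : Set (ℕ → T) := {s | ∃ x, A.InfRun x s}

/-- current-state estimate `M_O(S, σ)` under the observation map `O`. -/
def est (A : FSA X T Λ) (O : T → Option Λ) (σ : List Λ) : Set X :=
  {x | ∃ x0 ∈ A.init, ∃ w : List T, obsW O w = σ ∧ A.Run x0 w x}

/-- `y` is reachable from `x` (by a nonempty word). -/
def Reach (A : FSA X T Λ) (x y : X) : Prop := ∃ w : List T, w ≠ [] ∧ A.Run x w y

/-- `y` lies on a transition cycle. -/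
def OnCycle (A : FSA X T Λ) (y : X) : Prop := ∃ w : List T, w ≠ [] ∧ A.Run y w y

/-- the normal sub-automaton: all faulty transitions removed. -/
def normal (A : FSA X T Λ) (Tf : Set T) : FSA X T Λ :=
  ⟨A.init, {tr | tr ∈ A.trans ∧ tr.2.1 ∉ Tf}, A.lbl⟩

/-- local automaton: same data, re-labelled by a local observation map. -/
def localAut (A : FSA X T Λ) (O : T → Option Λ) : FSA X T Λ :=
  ⟨A.init, A.trans, O⟩

end FSA

/-- local observation map of an observer with observable event set `To`:
it sees the global label on events of `To` and nothing otherwise. -/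
noncomputable def localObs {T : Type*} {Λ : Type*} (ℓ : T → Option Λ) (To : Set T) :
    T → Option Λ :=
  fun t => @ite _ (t ∈ To) (Classical.propDecidable _) (ℓ t) none

/-- the first `n` events of an infinite event sequence. -/
def pre {T : Type*} (s : ℕ → T) (n : ℕ) : List T := (List.range n).map s

/-- `s ∈ T*T_f`: the word `s` ends with a faulty event. -/
def endsFaulty {T : Type*} (Tf : Set T) (s : List T) : Prop :=
  ∃ (s₁ : List T) (t : T), t ∈ Tf ∧ s = s₁ ++ [t]

/-- `T_f ∈ s`: the word `s` contains a faulty event. -/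
def hasFault {T : Type*} (Tf : Set T) (s : List T) : Prop := ∃ t ∈ s, t ∈ Tf

namespace FSA

variable {X : Type*} {T : Type*} {Λ : Type*} {L : ℕ}

/-- O-co-detectability (Definition CoDet). -/
def CoDetectable (A : FSA X T Λ) (O : Fin L → T → Option Λ) : Prop :=
  ∃ k : ℕ, ∀ s ∈ A.LangW, ∃ i : Fin L, ∀ n : ℕ,
    k ≤ (obsW (O i) (pre s n)).length →
    (A.est (O i) (obsW (O i) (pre s n))).ncard = 1

/-- strong detectability (Definition StrDet). -/
def StronglyDetectable (A : FSA X T Λ) : Prop :=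
  ∃ k : ℕ, ∀ s ∈ A.LangW, ∀ n : ℕ,
    k ≤ (obsW A.lbl (pre s n)).length →
    (A.est A.lbl (obsW A.lbl (pre s n))).ncard = 1

/-- (O, T_f)-co-diagnosability (Definition CoDiag). -/
def CoDiagnosable (A : FSA X T Λ) (O : Fin L → T → Option Λ) (Tf : Set T) : Prop :=
  ∃ k : ℕ, ∀ s s' : List T, s ∈ A.Lang → endsFaulty Tf s → s ++ s' ∈ A.Lang →
    k ≤ s'.length →
    ∃ i : Fin L, ∀ s'' ∈ A.Lang, obsW (O i) s'' = obsW (O i) (s ++ s') → hasFault Tf s''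

/-- T_f-diagnosability (Definition Diag). -/
def Diagnosable (A : FSA X T Λ) (Tf : Set T) : Prop :=
  ∃ k : ℕ, ∀ s s' : List T, s ∈ A.Lang → endsFaulty Tf s → s ++ s' ∈ A.Lang →
    k ≤ s'.length →
    ∀ s'' ∈ A.Lang, obsW A.lbl s'' = obsW A.lbl (s ++ s') → hasFault Tf s''

/-- (O, T_f)-co-predictability (Definition CoPred). -/
def CoPredictable (A : FSA X T Λ) (O : Fin L → T → Option Λ) (Tf : Set T) : Prop :=
  ∃ k : ℕ, ∀ s ∈ A.Lang, endsFaulty Tf s →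
    ∃ s' : List T, s' <+: s ∧ ¬ hasFault Tf s' ∧
      ∃ i : Fin L, ∀ u v : List T, u ++ v ∈ A.Lang → obsW (O i) s' = obsW (O i) u →
        ¬ hasFault Tf u → k ≤ v.length → hasFault Tf v

/-- T_f-predictability (Definition Pred). -/
def Predictable (A : FSA X T Λ) (Tf : Set T) : Prop :=
  ∃ k : ℕ, ∀ s ∈ A.Lang, endsFaulty Tf s →
    ∃ s' : List T, s' <+: s ∧ ¬ hasFault Tf s' ∧
      ∀ u v : List T, u ++ v ∈ A.Lang → obsW A.lbl s' = obsW A.lbl u →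
        ¬ hasFault Tf u → k ≤ v.length → hasFault Tf v

end FSA

section CC

variable {T : Type*} {Λ : Type*} {L : ℕ}

/-- labelling extended to `Option T` (with `none` = ε). -/
def obsE (ℓ : T → Option Λ) : Option T → Option Λ := fun t? => t?.bind ℓ

/-- one optional step: `none` = stay put, `some t` = take a `t`-transition. -/
def stepOpt {X : Type*} (tr : Set (X × T × X)) : X → Option T → X → Prop :=
  fun x t? y =>
    match t? with
    | none => x = y
    | some t => (x, t, y) ∈ tr

/-- validity of a composite event of the concurrent composition,
restricted to the "active" local components `act`. -/
def ccEventOn (ℓs : Fin L → T → Option Λ) (act : Fin L → Prop)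
    (t0 : Option T) (ts : Fin L → Option T) : Prop :=
  ((∀ j, act j → obsE (ℓs j) t0 = none) ∧
   (∀ j, act j → obsE (ℓs j) (ts j) = none) ∧
   ((t0 ≠ none ∧ ∀ j, act j → ts j = none) ∨
    (t0 = none ∧ ∃ j, act j ∧ ts j ≠ none ∧ ∀ j', act j' → j' ≠ j → ts j' = none)))
  ∨
  ((∃ j, act j ∧ obsE (ℓs j) t0 ≠ none) ∧
   (∀ l, act l →
     (obsE (ℓs l) t0 = none → ts l = none) ∧
     (obsE (ℓs l) t0 ≠ none → obsE (ℓs l) (ts l) = obsE (ℓs l) t0)))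

/-- validity of a composite event of the concurrent composition. -/
def ccEvent (ℓs : Fin L → T → Option Λ) (t0 : Option T) (ts : Fin L → Option T) : Prop :=
  ccEventOn ℓs (fun _ => True) t0 ts

/-- transition relation of the concurrent composition `CC_A(A0; A 0, …, A (L-1))`. -/
def ccTrans {X0 : Type*} {Xs : Fin L → Type*}
    (A0 : FSA X0 T Λ) (A : ∀ i, FSA (Xs i) T Λ) :
    (X0 × (∀ i, Xs i)) → (Option T × (Fin L → Option T)) → (X0 × (∀ i, Xs i)) → Prop :=
  fun p e q =>
    ccEvent (fun i => (A i).lbl) e.1 e.2 ∧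
    stepOpt A0.trans p.1 e.1 q.1 ∧
    ∀ i, stepOpt (A i).trans (p.2 i) (e.2 i) (q.2 i)

/-- initial states of the concurrent composition. -/
def ccInit {X0 : Type*} {Xs : Fin L → Type*}
    (A0 : FSA X0 T Λ) (A : ∀ i, FSA (Xs i) T Λ) : Set (X0 × (∀ i, Xs i)) :=
  {p | p.1 ∈ A0.init ∧ ∀ i, p.2 i ∈ (A i).init}

end CC

section Dia

/-- events of the ⋄-variant of the concurrent composition: ε, an event of `T`,
or the fresh event ⋄. -/
inductive DEv (T : Type*) where
  | eps : DEv T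
  | ev : T → DEv T
  | dia : DEv T

variable {X : Type*} {T : Type*} {Λ : Type*} {L : ℕ}

def devOf : Option T → DEv T
  | none => DEv.eps
  | some t => DEv.ev t

def devToOpt : DEv T → Option T
  | DEv.ev t => some t
  | _ => none

/-- transition relation of the variant concurrent composition
`CC_A^⋄(S; S_1, …, S_L)` of an FSA `A` with its local automata given by the
local observation maps `O i`.  A local component equal to `none` is the fresh
state ⋄. -/
def diaTrans (A : FSA X T Λ) (O : Fin L → T → Option Λ) :
    (X × (Fin L → Option X)) → (Option T × (Fin L → DEv T)) →
    (X × (Fin L → Option X)) → Prop :=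
  fun p e q =>
    -- an ordinary transition of the concurrent composition (all components in X)
    ((∃ ts : Fin L → Option T,
        (∀ i, e.2 i = devOf (ts i)) ∧
        ccEvent O e.1 ts ∧
        stepOpt A.trans p.1 e.1 q.1 ∧
        (∀ i, ∃ xi yi, p.2 i = some xi ∧ q.2 i = some yi ∧ stepOpt A.trans xi (ts i) yi)))
    ∨
    -- the extra ⋄-transitions, at states with some component differing from the 0-th
    ((∃ i, p.2 i ≠ some p.1) ∧
     (∀ i, p.2 i ≠ some p.1 → e.2 i = DEv.dia ∧ q.2 i = none) ∧
     (∃ ts : Fin L → Option T,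
        (∀ i, p.2 i = some p.1 → e.2 i = devOf (ts i)) ∧
        ((ccEventOn O (fun i => p.2 i = some p.1) e.1 ts ∧
          stepOpt A.trans p.1 e.1 q.1 ∧
          (∀ i, p.2 i = some p.1 → ∃ yi, q.2 i = some yi ∧ stepOpt A.trans p.1 (ts i) yi))
         ∨
         (e.1 = none ∧ q.1 = p.1 ∧
          (∀ i, p.2 i = some p.1 → ts i = none ∧ q.2 i = some p.1)))))

/-- initial states of the variant concurrent composition. -/
def diaInit (A : FSA X T Λ) : Set (X × (Fin L → Option X)) :=
  {p | p.1 ∈ A.init ∧ ∀ i, ∃ z ∈ A.init, p.2 i = some z}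

end Dia

/-- a (possibly partial) deterministic finite automaton. -/
structure PDFA (Q : Type*) (A : Type*) where
  start : Q
  accept : Set Q
  trans : Set (Q × A × Q)
  deterministic : ∀ q a q' q'', (q, a, q') ∈ trans → (q, a, q'') ∈ trans → q' = q''

namespace PDFA

variable {Q : Type*} {A : Type*}

def step (M : PDFA Q A) (q : Q) (a : A) (q' : Q) : Prop := (q, a, q') ∈ M.trans

def Accepts (M : PDFA Q A) (w : List A) : Prop :=
  ∃ q, RunRel M.step M.start w q ∧ q ∈ M.accept

def Acyclic (M : PDFA Q A) : Prop := ¬ ∃ (q : Q) (w : List A), w ≠ [] ∧ RunRel M.step q w q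

def Complete (M : PDFA Q A) : Prop := ∀ q a, ∃ q', (q, a, q') ∈ M.trans

def Deadlock (M : PDFA Q A) (q : Q) : Prop := ∀ a q', (q, a, q') ∉ M.trans

def DeadlockFree (M : PDFA Q A) : Prop := ∀ q, ∃ a q', (q, a, q') ∈ M.trans

end PDFA

end DES

namespace DES

theorem RunRel.append {S E : Type*} {δ : S → E → S → Prop} {x y z : S} {u v : List E}
    (h : RunRel δ x u y) (h' : RunRel δ y v z) : RunRel δ x (u ++ v) z := by
  induction h with
  | nil x => exact h'
  | cons a _ ih => exact RunRel.cons a (ih h')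

theorem RunRel.split {S E : Type*} {δ : S → E → S → Prop} (u : List E) :
    ∀ {x z : S} {v : List E}, RunRel δ x (u ++ v) z →
      ∃ y, RunRel δ x u y ∧ RunRel δ y v z := by
  induction u with
  | nil => intro x z v h; exact ⟨x, RunRel.nil x, h⟩
  | cons e u ih =>
    intro x z v h
    cases h with
    | cons a b =>
      obtain ⟨y, h1, h2⟩ := ih b
      exact ⟨y, RunRel.cons a h1, h2⟩

section
variable {X T Λ : Type*}

theorem run_of_normal {A : FSA X T Λ} {Tf : Set T} {x y : X} {w : List T}
    (h : (A.normal Tf).Run x w y) : A.Run x w y ∧ ¬ hasFault Tf w := by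
  unfold FSA.Run at *
  induction h with
  | nil x => exact ⟨RunRel.nil x, by simp [hasFault]⟩
  | cons a _ ih =>
    refine ⟨RunRel.cons a.1 ih.1, ?_⟩
    rintro ⟨t, ht, hf⟩
    rcases List.mem_cons.1 ht with rfl | ht
    · exact a.2 hf
    · exact ih.2 ⟨t, ht, hf⟩

theorem normal_of_run {A : FSA X T Λ} {Tf : Set T} {x y : X} {w : List T}
    (h : A.Run x w y) (hw : ¬ hasFault Tf w) : (A.normal Tf).Run x w y := by
  unfold FSA.Run at *
  induction h with
  | nil x => exact RunRel.nil x
  | cons a _ ih =>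
    refine RunRel.cons ⟨a, fun hf => hw ⟨_, List.mem_cons_self, hf⟩⟩
      (ih fun ⟨t, ht, hf⟩ => hw ⟨t, List.mem_cons_of_mem _ ht, hf⟩)

theorem cycle_of_long [Fintype X] {A : FSA X T Λ} {x y : X} {v : List T}
    (h : A.Run x v y) : ∀ V : Finset X, (∀ q ∈ V, A.Reach q x) →
      Fintype.card X ≤ V.card + v.length →
      ∃ z, (z = x ∨ A.Reach x z) ∧ A.OnCycle z := by
  classical
  unfold FSA.Run at h
  induction h with
  | nil x =>
    intro V hV hc
    have : V = Finset.univ := by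
      apply Finset.eq_univ_of_card
      exact le_antisymm (Finset.card_le_univ V) (by simpa using hc)
    exact ⟨x, Or.inl rfl, hV x (by simp [this])⟩
  | @cons x y z e w a _ ih =>
    intro V hV hc
    by_cases hx : x ∈ V
    · exact ⟨x, Or.inl rfl, hV x hx⟩
    have hxy : A.Reach x y := ⟨[e], by simp, RunRel.cons a (RunRel.nil _)⟩
    obtain ⟨z, hz, hcy⟩ := ih (insert x V) (by
      intro q hq
      rcases Finset.mem_insert.1 hq with rfl | hq
      · exact hxy
      · obtain ⟨w, _, hr⟩ := hV q hq
        exact ⟨w ++ [e], by simp, RunRel.append hr (RunRel.cons a (RunRel.nil _))⟩) (by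
      rw [Finset.card_insert_of_notMem hx]
      simp at hc
      omega)
    refine ⟨z, Or.inr ?_, hcy⟩
    rcases hz with rfl | ⟨w', _, hr⟩
    · exact hxy
    · exact ⟨e :: w', by simp, RunRel.cons a hr⟩

theorem cycle_pump {A : FSA X T Λ} {x : X} (h : A.OnCycle x) (k : ℕ) :
    ∃ w, k ≤ w.length ∧ A.Run x w x := by
  obtain ⟨c, hc, hr⟩ := h
  induction k with
  | zero => exact ⟨[], by simp, RunRel.nil x⟩
  | succ k ih =>
    obtain ⟨w, hw, hw'⟩ := ih
    refine ⟨c ++ w, ?_, RunRel.append hr hw'⟩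
    have := List.length_pos_iff.2 hc
    simp
    omega

theorem obs_split {ℓ : T → Option Λ} (w : List T) : ∀ (a b : List Λ), obsW ℓ w = a ++ b →
    ∃ u v, w = u ++ v ∧ obsW ℓ u = a := by
  induction w with
  | nil => intro a b h; exact ⟨[], [], rfl, by simp [obsW] at *; simp [h.1]⟩
  | cons t w ih =>
    intro a b h
    cases a with
    | nil => exact ⟨[], t :: w, rfl, rfl⟩
    | cons l a =>
      cases hl : ℓ t with
      | none =>
        obtain ⟨u, v, rfl, hu⟩ := ih (l :: a) b (by simpa [obsW, hl] using h)
        exact ⟨t :: u, v, rfl, by simpa [obsW, hl] using hu⟩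
      | some m =>
        simp [obsW, hl] at h
        obtain ⟨u, v, rfl, hu⟩ := ih a b h.2
        exact ⟨t :: u, v, rfl, by simp [obsW, hl, h.1]; exact hu⟩

theorem cc_proj {B : FSA X T Λ} {p q : X × (Fin 1 → X)}
    {w : List (Option T × (Fin 1 → Option T))}
    (h : RunRel (ccTrans B (fun _ : Fin 1 => B)) p w q) :
    ∃ u v, B.Run p.1 u q.1 ∧ B.Run (p.2 0) v (q.2 0) ∧ obsW B.lbl u = obsW B.lbl v := by
  induction h with
  | nil x => exact ⟨[], [], RunRel.nil _, RunRel.nil _, rfl⟩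
  | @cons p q r e w a _ ih =>
    obtain ⟨u, v, hu, hv, ho⟩ := ih
    obtain ⟨he, h0, h1⟩ := a
    have h1 := h1 0
    obtain ⟨t0, ts⟩ := e
    have hobs : obsE B.lbl t0 = obsE B.lbl (ts 0) := by
      rcases he with ⟨h, h', _⟩ | ⟨⟨j, _, hj⟩, h⟩
      · exact (h 0 trivial).trans (h' 0 trivial).symm
      · exact ((h 0 trivial).2 hj).symm
    refine ⟨t0.toList ++ u, (ts 0).toList ++ v, ?_, ?_, ?_⟩
    · cases t0 with
      | none => simp only [stepOpt] at h0; rw [h0]; exact hu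
      | some t => exact RunRel.cons h0 hu
    · dsimp only at h1
      cases hts : ts 0 with
      | none => simp only [hts, stepOpt] at h1; rw [h1]; exact hv
      | some t => rw [hts] at h1; exact RunRel.cons h1 hv
    · have key : ∀ o : Option T, obsW B.lbl o.toList = (obsE B.lbl o).toList := by
        intro o
        cases o with
        | none => rfl
        | some t => cases hl : B.lbl t <;> simp [obsW, obsE, hl]
      have app : ∀ a b, obsW B.lbl (a ++ b) = obsW B.lbl a ++ obsW B.lbl b := by
        intro a b; simp [obsW]
      rw [app, app, key, key, hobs, ho]

theorem cc_right {B : FSA X T Λ} {x y y' : X} {t : T} (hl : B.lbl t = none)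
    (h : B.step y t y') :
    ccTrans B (fun _ : Fin 1 => B) (x, fun _ => y) (none, fun _ => some t) (x, fun _ => y') := by
  refine ⟨Or.inl ⟨fun _ _ => rfl, fun _ _ => hl, Or.inr ⟨rfl, 0, trivial, by simp, ?_⟩⟩, rfl,
    fun _ => h⟩
  intro j _ hj
  exact absurd (Subsingleton.elim j 0) hj

theorem cc_left {B : FSA X T Λ} {x x' y : X} {t : T} (hl : B.lbl t = none)
    (h : B.step x t x') :
    ccTrans B (fun _ : Fin 1 => B) (x, fun _ => y) (some t, fun _ => none) (x', fun _ => y) :=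
  ⟨Or.inl ⟨fun _ _ => hl, fun _ _ => rfl, Or.inl ⟨by simp, fun _ _ => rfl⟩⟩, h, fun _ => rfl⟩

theorem cc_both {B : FSA X T Λ} {x x' y y' : X} {t t' : T} {l : Λ} (hl : B.lbl t = some l)
    (hl' : B.lbl t' = some l) (h : B.step x t x') (h' : B.step y t' y') :
    ccTrans B (fun _ : Fin 1 => B) (x, fun _ => y) (some t, fun _ => some t')
      (x', fun _ => y') :=
  ⟨Or.inr ⟨⟨0, trivial, by simp [obsE, hl]⟩, fun _ _ => ⟨by simp [obsE, hl],
    by simp [obsE, hl, hl']⟩⟩, h, fun _ => h'⟩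

theorem cc_sync {B : FSA X T Λ} {x x' : X} {u : List T} (hu : B.Run x u x') :
    ∀ {y y' : X} {v : List T}, B.Run y v y' → obsW B.lbl u = obsW B.lbl v →
    ∃ w, RunRel (ccTrans B (fun _ : Fin 1 => B)) (x, fun _ => y) w (x', fun _ => y') := by
  unfold FSA.Run at *
  induction hu with
  | nil x =>
    intro y y' v hv
    induction hv with
    | nil y => intro _; exact ⟨[], RunRel.nil _⟩
    | @cons y z y' t v a _ ih =>
      intro ho
      cases hl : B.lbl t with
      | some l => simp [obsW, hl] at ho
      | none =>
        obtain ⟨w, hw⟩ := ih (by simpa [obsW, hl] using ho)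
        exact ⟨_, RunRel.cons (cc_right hl a) hw⟩
  | @cons x z x' t u a _ ih =>
    intro y y' v hv ho
    cases hl : B.lbl t with
    | none =>
      obtain ⟨w, hw⟩ := ih hv (by simpa [obsW, hl] using ho)
      exact ⟨_, RunRel.cons (cc_left hl a) hw⟩
    | some l =>
      induction hv with
      | nil y => simp [obsW, hl] at ho
      | @cons y z' y' t' v a' hr ih' =>
        cases hl' : B.lbl t' with
        | none =>
          obtain ⟨w, hw⟩ := ih' (by simpa [obsW, hl'] using ho)
          exact ⟨_, RunRel.cons (cc_right hl' a') hw⟩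
        | some l' =>
          simp [obsW, hl, hl'] at ho
          obtain ⟨rfl, ho⟩ := ho
          obtain ⟨w, hw⟩ := ih hr ho
          exact ⟨_, RunRel.cons (cc_both hl hl' a a') hw⟩

theorem first_fault {Tf : Set T} (s : List T) (h : hasFault Tf s) :
    ∃ s' t r, s = s' ++ t :: r ∧ t ∈ Tf ∧ ¬ hasFault Tf s' := by
  induction s with
  | nil => simp [hasFault] at h
  | cons e s ih =>
    by_cases he : e ∈ Tf
    · exact ⟨[], e, s, rfl, he, by simp [hasFault]⟩
    · obtain ⟨s', t, r, rfl, ht, hs⟩ := ih (by simpa [hasFault, he] using h)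
      exact ⟨e :: s', t, r, rfl, ht, by simpa [hasFault, he] using hs⟩

end

end DES

open DES in
/-- Theorem (predictability criterion): an FSA is not T_f-predictable iff in
`CC_A(S^n; S^n)` there is a reachable state `(x_1, x̄_1)` such that
`(x_1, t_f, x_2) ∈ δ` for some faulty `t_f`, and in `S^n` some state `x_3`
equal to `x̄_1` or reachable from `x̄_1` lies on a transition cycle of `S^n`. -/
theorem not_predictable_iff_cc_witness
    {X : Type*} {T : Type*} {Λ : Type*} [Fintype X] [Fintype T]
    (A : FSA X T Λ) (Tf : Set T) :
    ¬ A.Predictable Tf ↔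
    ∃ p : X × (Fin 1 → X),
      (∃ p0 ∈ ccInit (A.normal Tf) (fun _ : Fin 1 => A.normal Tf),
        ∃ w, RunRel (ccTrans (A.normal Tf) (fun _ : Fin 1 => A.normal Tf)) p0 w p) ∧
      (∃ tf ∈ Tf, ∃ x2 : X, (p.1, tf, x2) ∈ A.trans) ∧
      (∃ x3 : X, (x3 = p.2 0 ∨ (A.normal Tf).Reach (p.2 0) x3) ∧
        (A.normal Tf).OnCycle x3) := by
  constructor
  · intro hP
    by_contra hW
    apply hP
    refine ⟨Fintype.card X, fun s hs hf => ?_⟩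
    obtain ⟨s₁, t₁, ht₁, hs₁⟩ := hf
    obtain ⟨s', t, r, rfl, ht, hs'⟩ := first_fault (Tf := Tf) s ⟨t₁, by simp [hs₁], ht₁⟩
    refine ⟨s', List.prefix_append _ _, hs', fun u v huv ho hu hv => ?_⟩
    by_contra hvf
    apply hW
    obtain ⟨x0, hx0, x, hx⟩ := hs
    obtain ⟨x1, h1, h2⟩ := RunRel.split s' hx
    obtain ⟨y0, hy0, y, hy⟩ := huv
    obtain ⟨y1, h3, h4⟩ := RunRel.split u hy
    obtain ⟨w, hw⟩ := cc_sync (normal_of_run h1 hs') (normal_of_run h3 hu) ho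
    refine ⟨(x1, fun _ => y1), ⟨(x0, fun _ => y0), ⟨hx0, fun _ => hy0⟩, w, hw⟩, ?_, ?_⟩
    · cases h2 with
      | cons a _ => exact ⟨t, ht, _, a⟩
    · exact cycle_of_long (normal_of_run h4 hvf) ∅ (by simp) (by simpa using hv)
  · rintro ⟨⟨x1, y1⟩, ⟨p0, ⟨hp0, hp0'⟩, w, hw⟩, ⟨tf, htf, x2, hx2⟩, x3, hx3, hcy⟩ ⟨k, hk⟩
    obtain ⟨a, b, ha, hb, hab⟩ := cc_proj hw
    obtain ⟨ha, haf⟩ := run_of_normal ha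
    obtain ⟨s', ⟨r, hr⟩, hs', H⟩ := hk (a ++ [tf])
      ⟨p0.1, hp0, x2, RunRel.append ha (RunRel.cons hx2 (RunRel.nil _))⟩ ⟨a, tf, htf, rfl⟩
    have hpre : ∃ r', a = s' ++ r' := by
      rcases List.eq_nil_or_concat r with rfl | ⟨r', z, rfl⟩
      · exact absurd ⟨tf, by simp at hr; simp [hr], htf⟩ hs'
      · rw [List.concat_eq_append, ← List.append_assoc] at hr
        exact ⟨r', (List.append_inj_left' hr rfl).symm⟩
    obtain ⟨r', rfl⟩ := hpre
    obtain ⟨u, v, rfl, hu⟩ := obs_split (ℓ := A.lbl) b (obsW A.lbl s') (obsW A.lbl r')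
      (by rw [show obsW A.lbl b = _ from hab.symm]; simp [obsW, FSA.normal])
    obtain ⟨c, hc, hcr⟩ := cycle_pump hcy k
    obtain ⟨d, hd⟩ : ∃ d, (A.normal Tf).Run (y1 0) d x3 := by
      rcases hx3 with rfl | ⟨d, _, hd⟩
      · exact ⟨[], RunRel.nil _⟩
      · exact ⟨d, hd⟩
    obtain ⟨hR, hF⟩ := run_of_normal (RunRel.append hb (RunRel.append hd hcr))
    have hv := H u (v ++ (d ++ c)) ⟨p0.2 0, hp0' 0, x3, by simpa using hR⟩ hu.symm
      (fun ⟨t, ht, hf⟩ => hF ⟨t, by simp [ht], hf⟩) (by simp; omega)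
    obtain ⟨t, ht, hf⟩ := hv
    exact hF ⟨t, by simp at ht ⊢; tauto, hf⟩
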